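/- For any d-angulation T of a convex n-gon and vertices i ≠ j, the number of counterclockwise d-paths from i to j equals the number of clockwise d-paths from i to j. -/

import Mathlib

noncomputable section

/-- The `k`-th vertex of a regular `n`-gon inscribed in the unit circle. -/
def vtx (n : ℕ) (k : ZMod n) : ℝ × ℝ :=
  (Real.cos (2 * Real.pi * k.val / n), Real.sin (2 * Real.pi * k.val / n))

/-- The convex hull spanned by a set `c` of vertices of the `n`-gon. -/
def cellHull (n : ℕ) (c : Finset (ZMod n)) : Set (ℝ × ℝ) :=
  convexHull ℝ (vtx n '' (c : Set (ZMod n)))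

/-- `T` is a `d`-angulation of the convex `n`-gon: a dissection of the polygon by
pairwise non-crossing diagonals into `d`-gon cells.  Each cell is recorded by its
vertex set; the cells cover the polygon and have pairwise disjoint interiors. -/
def IsDAngulation (n d : ℕ) (T : Finset (Finset (ZMod n))) : Prop :=
  (∀ c ∈ T, c.card = d) ∧
  (⋃ c ∈ T, cellHull n c) = convexHull ℝ (Set.range (vtx n)) ∧
  ∀ c ∈ T, ∀ c' ∈ T, c ≠ c' →
    interior (cellHull n c) ∩ interior (cellHull n c') = ∅

/-- The number of vertices strictly between `i` and `j`, going counterclockwise. -/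
def pathLen (n : ℕ) (i j : ZMod n) : ℕ := (j - i - 1).val

/-- A (counterclockwise) `d`-path from `i` to `j` in the `d`-angulation `T`:
a sequence `p_{i+1}, …, p_{j-1}` of cells of `T`, indexed by the vertices
encountered going counterclockwise from `i` to `j`, such that the cell at
position `k` is incident to the vertex `i+1+k`, and each cell of `T` occurs
at most `d - 2` times in the sequence. -/
def IsDPath (n d : ℕ) (T : Finset (Finset (ZMod n))) (i j : ZMod n)
    (q : Fin (pathLen n i j) → {c // c ∈ T}) : Prop :=
  (∀ k, (i + 1 + ((k : ℕ) : ZMod n)) ∈ (q k : Finset (ZMod n))) ∧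
  ∀ c ∈ T, (Finset.univ.filter (fun k => (q k : Finset (ZMod n)) = c)).card ≤ d - 2

/-- The number `m_{i,j}` of counterclockwise `d`-paths from `i` to `j`. -/
def dPathCount (n d : ℕ) (T : Finset (Finset (ZMod n))) (i j : ZMod n) : ℕ :=
  Nat.card {q : Fin (pathLen n i j) → {c // c ∈ T} // IsDPath n d T i j q}

/-- A clockwise `d`-path from `i` to `j`: a sequence of cells indexed by the
vertices `i-1, i-2, …, j+1` encountered going clockwise from `i` to `j`, each cell
incident to the corresponding vertex and each cell occurring at most `d - 2`
times. -/
def IsCWDPath (n d : ℕ) (T : Finset (Finset (ZMod n))) (i j : ZMod n)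
    (q : Fin (pathLen n j i) → {c // c ∈ T}) : Prop :=
  (∀ k, (i - 1 - ((k : ℕ) : ZMod n)) ∈ (q k : Finset (ZMod n))) ∧
  ∀ c ∈ T, (Finset.univ.filter (fun k => (q k : Finset (ZMod n)) = c)).card ≤ d - 2

/-- The number of clockwise `d`-paths from `i` to `j`. -/
def cwDPathCount (n d : ℕ) (T : Finset (Finset (ZMod n))) (i j : ZMod n) : ℕ :=
  Nat.card {q : Fin (pathLen n j i) → {c // c ∈ T} // IsCWDPath n d T i j q}

section Fillings

variable {α : Type*} [Fintype α]

open Classical in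
/-- The assignments of a cell of `T` incident to `v` to every `v ∈ S`, each cell being used at most
`d - 2` times; outside `S` the value is `∅`. -/
def fillings (d : ℕ) (T : Finset (Finset α)) (S : Finset α) : Finset (α → Finset α) :=
  Finset.univ.filter fun f => (∀ v ∈ S, f v ∈ T ∧ v ∈ f v) ∧ (∀ v ∉ S, f v = ∅) ∧
    ∀ c ∈ T, (S.filter fun v => f v = c).card ≤ d - 2

variable [DecidableEq α] {d : ℕ} {T : Finset (Finset α)} {S : Finset α}

lemma mem_fillings {f : α → Finset α} :
    f ∈ fillings d T S ↔ (∀ v ∈ S, f v ∈ T ∧ v ∈ f v) ∧ (∀ v ∉ S, f v = ∅) ∧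
      ∀ c ∈ T, (S.filter fun v => f v = c).card ≤ d - 2 := by
  simp only [fillings, Finset.mem_filter, Finset.mem_univ, true_and]
  congr!

lemma card_fillings_eq_zero_of_lt (h : (d - 2) * T.card < S.card) : (fillings d T S).card = 0 := by
  rw [Finset.card_eq_zero, Finset.eq_empty_iff_forall_notMem]
  intro f hf
  rw [mem_fillings] at hf
  have := Finset.card_le_mul_card_image_of_maps_to (fun v hv => (hf.1 v hv).1) (d - 2) hf.2.2
  omega

lemma card_fillings_eq_zero_of_uncovered {v : α} (hv : v ∈ S) (h : ∀ c ∈ T, v ∉ c) :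
    (fillings d T S).card = 0 := by
  rw [Finset.card_eq_zero, Finset.eq_empty_iff_forall_notMem]
  intro f hf
  rw [mem_fillings] at hf
  exact h _ (hf.1 v hv).1 (hf.1 v hv).2

lemma card_fillings_insert {E : Finset α} (hE : E ∉ T) :
    (fillings d (insert E T) S).card =
      ∑ A ∈ (S ∩ E).powerset.filter (fun A => A.card ≤ d - 2), (fillings d T (S \ A)).card := by
  rw [Finset.card_eq_sum_card_fiberwise (f := fun f => S.filter fun v => f v = E)
    (t := (S ∩ E).powerset.filter (fun A => A.card ≤ d - 2))]
  · refine Finset.sum_congr rfl fun A hA => ?_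
    simp only [Finset.mem_filter, Finset.mem_powerset] at hA
    obtain ⟨hAS, hAd⟩ := hA
    have hAS' : ∀ v ∈ A, v ∈ S ∧ v ∈ E := fun v hv => by simpa using hAS hv
    refine Finset.card_bij' (fun f _ v => if v ∈ A then ∅ else f v)
      (fun g _ v => if v ∈ A then E else g v) ?_ ?_ ?_ ?_
    · intro f hf
      simp only [Finset.mem_filter, mem_fillings] at hf
      obtain ⟨⟨h1, h2, h3⟩, rfl⟩ := hf
      simp only [mem_fillings]
      refine ⟨?_, ?_, ?_⟩
      · intro v hv
        have := h1 v
        simp_all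
      · intro v hv
        have := h2 v
        simp_all
      · intro c hc
        refine le_trans (Finset.card_le_card ?_) (h3 c (Finset.mem_insert_of_mem hc))
        intro v hv
        by_cases hvE : v ∈ S ∧ f v = E <;> simp_all
    · intro g hg
      simp only [mem_fillings] at hg
      obtain ⟨h1, h2, h3⟩ := hg
      have hfib : (S.filter fun v => (if v ∈ A then E else g v) = E) = A := by
        ext v
        have h1v := h1 v
        have hv := hAS' v
        by_cases hvA : v ∈ A
        · simp_all
        · simp only [hvA, Finset.mem_filter, if_false, iff_false, not_and]
          intro hvS hgE
          exact hE (hgE ▸ (h1v (by simp [hvS, hvA])).1)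
      simp only [Finset.mem_filter, mem_fillings]
      refine ⟨⟨?_, ?_, ?_⟩, hfib⟩
      · intro v hv
        have := h1 v
        have := hAS' v
        by_cases hvA : v ∈ A <;> simp_all
      · intro v hv
        have := h2 v
        have := hAS' v
        by_cases hvA : v ∈ A <;> simp_all
      · intro c hc
        rcases Finset.mem_insert.1 hc with rfl | hc'
        · rw [hfib]; exact hAd
        · refine le_trans (Finset.card_le_card ?_) (h3 c hc')
          intro v hv
          by_cases hvA : v ∈ A
          · simp only [Finset.mem_filter, hvA, if_true] at hv
            exact absurd (hv.2 ▸ hc') hE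
          · simp_all
    · intro f hf
      simp only [Finset.mem_filter, mem_fillings] at hf
      obtain ⟨_, rfl⟩ := hf
      funext v
      by_cases hv : v ∈ S ∧ f v = E <;> simp_all
    · intro g hg
      rw [mem_fillings] at hg
      funext v
      have := hg.2.1 v
      by_cases hvA : v ∈ A <;> simp_all
  · intro f hf
    rw [Finset.mem_coe, mem_fillings] at hf
    simp only [Finset.coe_filter, Finset.mem_powerset, Set.mem_ofPred_eq]
    refine ⟨fun v hv => ?_, hf.2.2 E (Finset.mem_insert_self _ _)⟩
    rw [Finset.mem_filter] at hv
    exact Finset.mem_inter.2 ⟨hv.1, hv.2 ▸ (hf.1 v hv.1).2⟩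

/-- Sequences of cells along an injective enumeration of `S` correspond to fillings of `S`. -/
lemma natCard_sequences_eq_card_fillings {L : ℕ} (e : Fin L → α) (he : Function.Injective e)
    (hS : Finset.univ.image e = S) :
    Nat.card {q : Fin L → {c // c ∈ T} // (∀ k, e k ∈ (q k : Finset α)) ∧
      ∀ c ∈ T, (Finset.univ.filter (fun k => (q k : Finset α) = c)).card ≤ d - 2} =
      (fillings d T S).card := by
  subst hS
  have hfib : ∀ (f : α → Finset α) c, ((Finset.univ.image e).filter fun v => f v = c).card =
      (Finset.univ.filter fun k => f (e k) = c).card := fun f c => by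
    rw [Finset.filter_image, Finset.card_image_of_injective _ he]
  rw [← Nat.card_eq_finsetCard]
  symm
  refine Nat.card_eq_of_bijective (fun f => ⟨fun k => ⟨f.1 (e k),
    ((mem_fillings.1 f.2).1 (e k) (Finset.mem_image_of_mem e (Finset.mem_univ k))).1⟩, ?_, ?_⟩)
    ⟨?_, ?_⟩
  · exact fun k => ((mem_fillings.1 f.2).1 (e k) (Finset.mem_image_of_mem e (Finset.mem_univ k))).2
  · intro c hc
    rw [← hfib]
    exact (mem_fillings.1 f.2).2.2 c hc
  · intro f g hfg
    ext1
    funext v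
    simp only [Subtype.mk.injEq, funext_iff] at hfg
    by_cases hv : v ∈ Finset.univ.image e
    · obtain ⟨k, -, rfl⟩ := Finset.mem_image.1 hv
      exact hfg k
    · rw [(mem_fillings.1 f.2).2.1 v hv, (mem_fillings.1 g.2).2.1 v hv]
  · rintro ⟨q, hq⟩
    have hext : ∀ k, Function.extend e (fun k => (q k : Finset α)) (fun _ => ∅) (e k) = q k :=
      fun k => he.extend_apply _ _ k
    refine ⟨⟨Function.extend e (fun k => (q k : Finset α)) (fun _ => ∅),
      mem_fillings.2 ⟨?_, ?_, ?_⟩⟩, ?_⟩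
    · intro v hv
      obtain ⟨k, -, rfl⟩ := Finset.mem_image.1 hv
      rw [hext]
      exact ⟨(q k).2, hq.1 k⟩
    · intro v hv
      refine Function.extend_apply' _ _ _ ?_
      simpa using hv
    · intro c hc
      rw [hfib]
      simpa only [hext] using hq.2 c hc
    · ext1
      funext k
      exact Subtype.ext (hext k)

lemma card_fillings_attach {B : Finset α} {x y : α}
    (hE : insert x (insert y B) ∉ T) (hTB : ∀ c ∈ T, ∀ v ∈ B, v ∉ c) (hB : B.card = d - 2)
    (hS : x ∉ S ∧ y ∉ S ∨ B ⊆ S) :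
    (fillings d (insert (insert x (insert y B)) T) S).card = (fillings d T (S \ B)).card := by
  rw [card_fillings_insert hE, Finset.sum_eq_single (B ∩ S)]
  · congr 2
    ext v
    grind
  · intro A hA hne
    simp only [Finset.mem_filter, Finset.mem_powerset] at hA
    by_cases hsub : B ∩ S ⊆ A
    · exfalso
      apply hne
      rcases hS with hS | hS
      · refine Finset.Subset.antisymm (fun v hv => ?_) hsub
        have := hA.1 hv
        grind
      · rw [Finset.inter_eq_left.2 hS] at hsub ⊢
        exact (Finset.eq_of_subset_of_card_le hsub (by omega)).symm
    · obtain ⟨v, hv, hvA⟩ := Finset.not_subset.1 hsub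
      rw [Finset.mem_inter] at hv
      exact card_fillings_eq_zero_of_uncovered (Finset.mem_sdiff.2 ⟨hv.2, hvA⟩)
        fun c hc => hTB c hc v hv.1
  · intro h
    exfalso
    apply h
    simp only [Finset.mem_filter, Finset.mem_powerset]
    refine ⟨fun v hv => by grind, ?_⟩
    exact hB ▸ Finset.card_le_card Finset.inter_subset_left

lemma card_fillings_attach_of_mem_right {B : Finset α} {x y : α}
    (hE : insert x (insert y B) ∉ T) (hTB : ∀ c ∈ T, ∀ v ∈ B, v ∉ c) (hyB : y ∉ B)
    (hBS : (B ∩ S).card < d - 2) (hx : x ∉ S) (hy : y ∈ S) :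
    (fillings d (insert (insert x (insert y B)) T) S).card =
      (fillings d T (S \ B)).card + (fillings d T (S \ insert y B)).card := by
  have hyBS : y ∉ B ∩ S := by grind
  have hne : B ∩ S ≠ insert y (B ∩ S) := fun h => hyBS (h ▸ Finset.mem_insert_self _ _)
  rw [card_fillings_insert hE, ← Finset.sum_subset (s₁ := {B ∩ S, insert y (B ∩ S)})]
  · rw [Finset.sum_pair hne]
    congr 3 <;> ext v <;> grind
  · intro A hA
    simp only [Finset.mem_insert, Finset.mem_singleton] at hA
    simp only [Finset.mem_filter, Finset.mem_powerset]
    rcases hA with rfl | rfl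
    · exact ⟨fun v hv => by grind, hBS.le⟩
    · exact ⟨fun v hv => by grind, by rw [Finset.card_insert_of_notMem hyBS]; omega⟩
  · intro A hA hne
    simp only [Finset.mem_filter, Finset.mem_powerset] at hA
    by_cases hsub : B ∩ S ⊆ A
    · exfalso
      apply hne
      simp only [Finset.mem_insert, Finset.mem_singleton]
      have hA1 : ∀ v ∈ A, v = y ∨ v ∈ B ∩ S := fun v hv => by
        have := hA.1 hv
        grind
      by_cases hyA : y ∈ A
      · right; ext v; grind
      · left; ext v; grind
    · obtain ⟨v, hv, hvA⟩ := Finset.not_subset.1 hsub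
      rw [Finset.mem_inter] at hv
      exact card_fillings_eq_zero_of_uncovered (Finset.mem_sdiff.2 ⟨hv.2, hvA⟩)
        fun c hc => hTB c hc v hv.1

lemma card_fillings_attach_of_mem_left {B : Finset α} {x y : α}
    (hE : insert x (insert y B) ∉ T) (hTB : ∀ c ∈ T, ∀ v ∈ B, v ∉ c) (hxB : x ∉ B)
    (hBS : (B ∩ S).card < d - 2) (hx : x ∈ S) (hy : y ∉ S) :
    (fillings d (insert (insert x (insert y B)) T) S).card =
      (fillings d T (S \ B)).card + (fillings d T (S \ insert x B)).card := by
  rw [Finset.insert_comm] at hE ⊢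
  exact card_fillings_attach_of_mem_right hE hTB hxB hBS hy hx

lemma card_fillings_attach_of_card {B : Finset α} {x y : α}
    (hE : insert x (insert y B) ∉ T) (hTB : ∀ c ∈ T, ∀ v ∈ B, v ∉ c) (hxy : x ≠ y)
    (hBS : (B ∩ S).card + 2 ≤ d - 2) (hx : x ∈ S) (hy : y ∈ S)
    (hcard : (S \ B).card = (d - 2) * T.card + 2) :
    (fillings d (insert (insert x (insert y B)) T) S).card =
      (fillings d T (S \ insert x (insert y B))).card := by
  rw [card_fillings_insert hE, Finset.sum_eq_single (insert x (insert y (B ∩ S)))]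
  · congr 2
    ext v
    grind
  · intro A hA hne
    simp only [Finset.mem_filter, Finset.mem_powerset] at hA
    by_cases hsub : B ∩ S ⊆ A
    · apply card_fillings_eq_zero_of_lt
      have hsdiff : S \ A = (S \ B) \ (A ∩ {x, y}) := by
        ext v
        have := @hA.1 v
        have := @hsub v
        grind
      have hssub : A ∩ {x, y} ⊂ ({x, y} : Finset α) := by
        refine ⟨Finset.inter_subset_right, fun h => hne ?_⟩
        have hxA : x ∈ A := (Finset.mem_inter.1 (h (by simp))).1
        have hyA : y ∈ A := (Finset.mem_inter.1 (h (by simp))).1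
        ext v
        have := @hA.1 v
        have := @hsub v
        grind
      have h1 := Finset.card_lt_card hssub
      rw [Finset.card_pair hxy] at h1
      have h2 := Finset.le_card_sdiff (A ∩ {x, y}) (S \ B)
      rw [hsdiff]
      omega
    · obtain ⟨v, hv, hvA⟩ := Finset.not_subset.1 hsub
      rw [Finset.mem_inter] at hv
      exact card_fillings_eq_zero_of_uncovered (Finset.mem_sdiff.2 ⟨hv.2, hvA⟩)
        fun c hc => hTB c hc v hv.1
  · intro h
    exfalso
    apply h
    simp only [Finset.mem_filter, Finset.mem_powerset]
    refine ⟨fun v hv => by grind, ?_⟩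
    exact (Finset.card_insert_le _ _).trans
      ((Nat.succ_le_succ (Finset.card_insert_le _ _)).trans hBS)

end Fillings

section EarDecomposition

variable {α : Type*} [LinearOrder α] {d : ℕ} {V : Finset α} {T : Finset (Finset α)}

/-- `T` is built from the edge of a 2-gon by successively attaching `d`-gons, each along a pair of
consecutive vertices; `V` is the set of vertices of the resulting polygon. -/
inductive EarDecomposition (d : ℕ) : Finset α → Finset (Finset α) → Prop
  | edge {x y : α} : x < y → EarDecomposition d {x, y} ∅
  | attach {V : Finset α} {T : Finset (Finset α)} {x y : α} {B : Finset α} :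
      EarDecomposition d V T → x ∈ V → y ∈ V → x < y → (∀ v ∈ V, ¬(x < v ∧ v < y)) →
      (∀ v ∈ B, x < v ∧ v < y) → B.card = d - 2 →
      EarDecomposition d (V ∪ B) (insert (insert x (insert y B)) T)

namespace EarDecomposition

lemma cell_subset (h : EarDecomposition d V T) : ∀ c ∈ T, c ⊆ V := by
  induction h with
  | edge => simp
  | attach h hx hy hxy hV hB hBd ih =>
    intro c hc
    rcases Finset.mem_insert.1 hc with rfl | hc
    · intro v hv; grind
    · exact (ih c hc).trans Finset.subset_union_left

lemma card_vertices (hd : 3 ≤ d) (h : EarDecomposition d V T) :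
    V.card = (d - 2) * T.card + 2 := by
  induction h with
  | edge h => simp [Finset.card_pair h.ne]
  | @attach V T x y B h hx hy hxy hV hB hBd ih =>
    have hdisj : Disjoint V B := Finset.disjoint_left.2 fun v hv hvB => hV v hv (hB v hvB)
    have hE : insert x (insert y B) ∉ T := by
      intro hE
      obtain ⟨v, hv⟩ := Finset.card_pos.1 (by omega : 0 < B.card)
      exact Finset.disjoint_left.1 hdisj (h.cell_subset _ hE (by simp [hv])) hv
    rw [Finset.card_union_of_disjoint hdisj, Finset.card_insert_of_notMem hE, ih, hBd]
    ring

set_option maxHeartbeats 2000000 in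
/-- The fillings of the two arcs complementary to a pair of vertices are equinumerous. -/
theorem card_fillings_inner_eq_outer [Fintype α] (hd : 3 ≤ d) (h : EarDecomposition d V T) :
    ∀ i ∈ V, ∀ j ∈ V, i < j →
      (fillings d T (V.filter fun v => i < v ∧ v < j)).card =
        (fillings d T (V.filter fun v => v < i ∨ j < v)).card := by
  induction h with
  | @edge x y h =>
    intro i hi j hj hij
    congr 2
    ext v
    grind
  | @attach V T x y B h hx hy hxy hV hB hBd ih =>
    have hcard := h.card_vertices hd
    have hTB : ∀ c ∈ T, ∀ v ∈ B, v ∉ c := fun c hc v hv hvc =>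
      hV v (h.cell_subset c hc hvc) (hB v hv)
    have hE : insert x (insert y B) ∉ T := by
      intro hE
      obtain ⟨v, hv⟩ := Finset.card_pos.1 (by omega : 0 < B.card)
      exact hTB _ hE v hv (by simp [hv])
    have hxB : x ∉ B := fun hx => lt_irrefl _ (hB x hx).1
    have hyB : y ∉ B := fun hy => lt_irrefl _ (hB y hy).2
    have hlt : ∀ {S : Finset α} {i : α}, i ∈ B → i ∉ S → (B ∩ S).card < d - 2 := by
      intro S i hi hiS
      rw [← hBd]
      exact Finset.card_lt_card
        ⟨Finset.inter_subset_left, fun h => hiS (Finset.mem_inter.1 (h hi)).2⟩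
    have hzero : ∀ z ∈ V, (fillings d T (V.filter fun v => v < z ∨ z < v)).card = 0 := by
      intro z hz
      apply card_fillings_eq_zero_of_lt
      have : (V.filter fun v => v < z ∨ z < v) = V.erase z := by ext v; grind
      rw [this, Finset.card_erase_of_mem hz]
      omega
    have hsdiff : ∀ (P Q : α → Prop) [DecidablePred P] [DecidablePred Q] (R : Finset α),
        (∀ v ∈ V, ¬(x < v ∧ v < y) → (P v ∧ v ∉ R ↔ Q v)) → B ⊆ R →
        (V ∪ B).filter P \ R = V.filter Q := by
      intro P Q _ _ R hPQ hBR
      ext v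
      have hv := @hBR v
      have := hPQ v
      have := hV v
      simp only [Finset.mem_sdiff, Finset.mem_filter, Finset.mem_union]
      tauto
    intro i hi j hj hij
    by_cases hiB : i ∈ B
    · have hi' := hB i hiB
      have hiV : i ∉ V := fun h => hV i h hi'
      by_cases hjB : j ∈ B
      · have hj' := hB j hjB
        have hjV : j ∉ V := fun h => hV j h hj'
        rw [card_fillings_attach hE hTB hBd (by grind),
          card_fillings_attach_of_card hE hTB hxy.ne _ (by grind) (by grind)]
        · rw [hsdiff _ (fun v => x < v ∧ v < y) _ (by grind) (by grind),
            hsdiff _ (fun v => v < x ∨ y < v) _ (by grind) (by grind)]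
          exact ih x hx y hy hxy
        · rw [← hcard, hsdiff _ (fun _ => True) _ (by grind) (by grind), Finset.filter_true]
        · have hsub : insert i (insert j (B ∩ (V ∪ B).filter fun v => v < i ∨ j < v)) ⊆ B := by
            intro v hv
            grind
          have := Finset.card_le_card hsub
          rw [Finset.card_insert_of_notMem (by grind), Finset.card_insert_of_notMem (by grind)]
            at this
          omega
      · have hjV : j ∈ V := by grind
        have hyj : y ≤ j := not_lt.1 fun hjy => hV j hjV ⟨hi'.1.trans hij, hjy⟩
        rw [card_fillings_attach_of_mem_left (S := (V ∪ B).filter fun v => v < i ∨ j < v) hE hTB hxB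
          (hlt hiB (by grind)) (by grind) (by grind),
          hsdiff _ (fun v => v < y ∨ j < v) _ (by grind) (by grind),
          hsdiff _ (fun v => v < x ∨ j < v) _ (by grind) (by grind)]
        rcases hyj.eq_or_lt with rfl | hyj
        · rw [card_fillings_attach hE hTB hBd (by grind),
            hsdiff _ (fun v => x < v ∧ v < y) _ (by grind) (by grind), hzero y hy, zero_add]
          exact ih x hx y hy hxy
        · rw [card_fillings_attach_of_mem_right hE hTB hyB (hlt hiB (by grind)) (by grind)
            (by grind),
            hsdiff _ (fun v => x < v ∧ v < j) _ (by grind) (by grind),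
            hsdiff _ (fun v => y < v ∧ v < j) _ (by grind) (by grind),
            ih x hx j hjV (hxy.trans hyj), ih y hy j hjV hyj, add_comm]
    · have hiV : i ∈ V := by grind
      by_cases hjB : j ∈ B
      · have hj' := hB j hjB
        have hix : i ≤ x := not_lt.1 fun hxi => hV i hiV ⟨hxi, hij.trans hj'.2⟩
        rw [card_fillings_attach_of_mem_right (S := (V ∪ B).filter fun v => v < i ∨ j < v) hE hTB
          hyB (hlt hjB (by grind)) (by grind) (by grind),
          hsdiff _ (fun v => v < i ∨ x < v) _ (by grind) (by grind),
          hsdiff _ (fun v => v < i ∨ y < v) _ (by grind) (by grind)]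
        rcases hix.eq_or_lt with rfl | hix
        · rw [card_fillings_attach hE hTB hBd (by grind),
            hsdiff _ (fun v => i < v ∧ v < y) _ (by grind) (by grind), hzero i hx, zero_add]
          exact ih i hx y hy hxy
        · rw [card_fillings_attach_of_mem_left hE hTB hxB (hlt hjB (by grind)) (by grind)
            (by grind),
            hsdiff _ (fun v => i < v ∧ v < y) _ (by grind) (by grind),
            hsdiff _ (fun v => i < v ∧ v < x) _ (by grind) (by grind),
            ih i hiV y hy (hix.trans hxy), ih i hiV x hx hix, add_comm]
      · have hjV : j ∈ V := by grind
        have hi' := hV i hiV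
        have hj' := hV j hjV
        rw [card_fillings_attach hE hTB hBd, card_fillings_attach hE hTB hBd,
          hsdiff _ (fun v => i < v ∧ v < j) _ (by grind) (by grind),
          hsdiff _ (fun v => v < i ∨ j < v) _ (by grind) (by grind)]
        · exact ih i hiV j hjV hij
        · by_cases hix : i ≤ x ∧ y ≤ j
          · grind
          · right
            intro v hv
            have := hB v hv
            grind
        · by_cases hix : i ≤ x ∧ y ≤ j
          · right
            intro v hv
            have := hB v hv
            grind
          · left
            grind

end EarDecomposition

/-- `T` is a family of non-crossing `d`-gons with vertices in `V`, whose extreme points are `lo` and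
`hi`, that leaves no gap: the chord `lo hi`, and every side of a cell, is a side of another cell
below it unless no vertex of `V` lies below it. -/
structure IsGaplessFamily (d : ℕ) (lo hi : α) (V : Finset α) (T : Finset (Finset α)) : Prop where
  lo_mem : lo ∈ V
  hi_mem : hi ∈ V
  lo_lt_hi : lo < hi
  bounds : ∀ v ∈ V, lo ≤ v ∧ v ≤ hi
  cell_subset : ∀ c ∈ T, c ⊆ V
  cell_card : ∀ c ∈ T, c.card = d
  noncrossing : ∀ c ∈ T, ∀ c' ∈ T, c ≠ c' → ∀ a ∈ c, ∀ b ∈ c, ∀ u ∈ c', a < u → u < b →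
    ∀ v ∈ c', a ≤ v ∧ v ≤ b
  root : (∃ v ∈ V, lo < v ∧ v < hi) → ∃ c ∈ T, lo ∈ c ∧ hi ∈ c
  gap : ∀ c ∈ T, ∀ a ∈ c, ∀ b ∈ c, (∀ v ∈ c, ¬(a < v ∧ v < b)) → (∃ v ∈ V, a < v ∧ v < b) →
    ∃ c' ∈ T, (∀ u ∈ c', a ≤ u ∧ u ≤ b) ∧ a ∈ c' ∧ b ∈ c'

namespace IsGaplessFamily

variable {lo hi : α}

/-- Some cell consists of consecutive vertices. -/
lemma exists_ear (hd : 3 ≤ d) (h : IsGaplessFamily d lo hi V T) (hT : T.Nonempty) :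
    ∃ E ∈ T, ∀ v ∈ V, ∀ a ∈ E, ∀ b ∈ E, a ≤ v → v ≤ b → v ∈ E := by
  obtain ⟨E, hE, hmin⟩ := Finset.exists_min_image T
    (fun c => (V.filter fun v => ∃ a ∈ c, ∃ b ∈ c, a ≤ v ∧ v ≤ b).card) hT
  refine ⟨E, hE, ?_⟩
  by_contra! hcon
  obtain ⟨v, hv, p, hp, q, hq, hpv, hvq, hvE⟩ := hcon
  have hpv' : p < v := lt_of_le_of_ne hpv fun h => hvE (h ▸ hp)
  have hvq' : v < q := lt_of_le_of_ne hvq fun h => hvE (h ▸ hq)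
  obtain ⟨a, ha, hamax⟩ := Finset.exists_max_image (E.filter (· < v)) id
    ⟨p, Finset.mem_filter.2 ⟨hp, hpv'⟩⟩
  obtain ⟨b, hb, hbmin⟩ := Finset.exists_min_image (E.filter (v < ·)) id
    ⟨q, Finset.mem_filter.2 ⟨hq, hvq'⟩⟩
  simp only [Finset.mem_filter, id] at ha hb hamax hbmin
  have hout : ∀ w ∈ E, w ≤ a ∨ b ≤ w := by
    intro w hw
    rcases lt_trichotomy w v with hwv | rfl | hwv
    · exact Or.inl (hamax w ⟨hw, hwv⟩)
    · exact absurd hw hvE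
    · exact Or.inr (hbmin w ⟨hw, hwv⟩)
  obtain ⟨c, hc, hcab, -, -⟩ := h.gap E hE a ha.1 b hb.1
    (fun w hw hwab => by rcases hout w hw with h | h <;> order) ⟨v, hv, ha.2, hb.2⟩
  obtain ⟨w, hw, hwab⟩ : ∃ w ∈ E, w ∉ ({a, b} : Finset α) := by
    by_contra! hsub
    have h1 := Finset.card_le_card (show E ⊆ {a, b} from hsub)
    have h2 := Finset.card_le_two (a := a) (b := b)
    have h3 := h.cell_card E hE
    omega
  simp only [Finset.mem_insert, Finset.mem_singleton, not_or] at hwab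
  refine absurd (hmin c hc) (not_le.2 (Finset.card_lt_card ?_))
  rw [Finset.ssubset_iff_of_subset]
  · refine ⟨w, Finset.mem_filter.2 ⟨h.cell_subset E hE hw, w, hw, w, hw, le_rfl, le_rfl⟩, ?_⟩
    rw [Finset.mem_filter]
    rintro ⟨-, p', hp', q', hq', hp'w, hwq'⟩
    have h1 := (hcab p' hp').1
    have h2 := (hcab q' hq').2
    rcases hout w hw with h | h
    · exact hwab.1 (by order)
    · exact hwab.2 (by order)
  · intro u hu
    rw [Finset.mem_filter] at hu ⊢
    obtain ⟨huV, p', hp', q', hq', hp'u, huq'⟩ := hu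
    exact ⟨huV, a, ha.1, b, hb.1, (hcab p' hp').1.trans hp'u, huq'.trans (hcab q' hq').2⟩

theorem earDecomposition (hd : 3 ≤ d) (h : IsGaplessFamily d lo hi V T) :
    EarDecomposition d V T := by
  induction T using Finset.strongInduction generalizing V with
  | H T ih =>
  by_cases hne : ∃ v ∈ V, lo < v ∧ v < hi
  · obtain ⟨r, hr, hlor, hhir⟩ := h.root hne
    obtain ⟨E, hE, hEconv⟩ := h.exists_ear hd ⟨r, hr⟩
    have hEcard := h.cell_card E hE
    have hEV := h.cell_subset E hE
    have hE0 : E.Nonempty := Finset.card_pos.1 (by omega)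
    obtain ⟨x, hx, hxmin⟩ := Finset.exists_min_image E id hE0
    obtain ⟨y, hy, hymax⟩ := Finset.exists_max_image E id hE0
    simp only [id] at hxmin hymax
    have hxy : x < y := by
      obtain ⟨p, hp, q, hq, hpq⟩ := Finset.one_lt_card.1 (by omega : 1 < E.card)
      refine lt_of_le_of_ne (hxmin y hy) fun hxy => hpq ?_
      have := hxmin p hp
      have := hxmin q hq
      have := hymax p hp
      have := hymax q hq
      order
    set B := (E.erase x).erase y with hB
    have hBmem : ∀ v ∈ B, v ∈ E ∧ x < v ∧ v < y := by
      intro v hv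
      simp only [hB, Finset.mem_erase] at hv
      exact ⟨hv.2.2, lt_of_le_of_ne (hxmin v hv.2.2) (Ne.symm hv.2.1),
        lt_of_le_of_ne (hymax v hv.2.2) hv.1⟩
    have hmemB : ∀ v ∈ V, x < v → v < y → v ∈ B := by
      intro v hv hxv hvy
      simp only [hB, Finset.mem_erase]
      exact ⟨hvy.ne, hxv.ne', hEconv v hv x hx y hy hxv.le hvy.le⟩
    have hEB : insert x (insert y B) = E := by
      ext v
      simp only [hB, Finset.mem_insert, Finset.mem_erase]
      grind
    have hBcard : B.card = d - 2 := by
      rw [hB, Finset.card_erase_of_mem (Finset.mem_erase.2 ⟨hxy.ne', hy⟩),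
        Finset.card_erase_of_mem hx, hEcard]
      omega
    have hBV : B ⊆ V := fun v hv => hEV (hBmem v hv).1
    have hnotB : ∀ c ∈ T, c ≠ E → ∀ v ∈ c, v ∉ B := by
      intro c hc hcE v hv hvB
      obtain ⟨-, hxv, hvy⟩ := hBmem v hvB
      refine hcE (Finset.eq_of_subset_of_card_le (fun w hw => ?_)
        (by rw [h.cell_card c hc, hEcard]))
      obtain ⟨h1, h2⟩ := h.noncrossing E hE c hc hcE.symm x hx y hy v hv hxv hvy w hw
      exact hEconv w (h.cell_subset c hc hw) x hx y hy h1 h2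
    have hloB : lo ∉ B := fun hl => by
      have h1 := (hBmem lo hl).2.1
      have h2 := (h.bounds x (hEV hx)).1
      order
    have hhiB : hi ∉ B := fun hl => by
      have h1 := (hBmem hi hl).2.2
      have h2 := (h.bounds y (hEV hy)).2
      order
    have h' : IsGaplessFamily d lo hi (V \ B) (T.erase E) := by
      refine ⟨Finset.mem_sdiff.2 ⟨h.lo_mem, hloB⟩, Finset.mem_sdiff.2 ⟨h.hi_mem, hhiB⟩,
        h.lo_lt_hi, fun v hv => h.bounds v (Finset.mem_sdiff.1 hv).1, ?_,
        fun c hc => h.cell_card c (Finset.mem_of_mem_erase hc),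
        fun c hc c' hc' => h.noncrossing c (Finset.mem_of_mem_erase hc) c'
          (Finset.mem_of_mem_erase hc'), ?_, ?_⟩
      · intro c hc v hv
        rw [Finset.mem_erase] at hc
        exact Finset.mem_sdiff.2 ⟨h.cell_subset c hc.2 hv, hnotB c hc.2 hc.1 v hv⟩
      · rintro ⟨v, hv, hlov, hvhi⟩
        rw [Finset.mem_sdiff] at hv
        refine ⟨r, Finset.mem_erase.2 ⟨?_, hr⟩, hlor, hhir⟩
        rintro rfl
        have h1 := hxmin lo hlor
        have h2 := hymax hi hhir
        exact hv.2 (hmemB v hv.1 (by order) (by order))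
      · rintro c hc a ha b hb hab ⟨v, hv, hav, hvb⟩
        rw [Finset.mem_sdiff] at hv
        obtain ⟨c', hc', hbd, hac', hbc'⟩ := h.gap c (Finset.mem_of_mem_erase hc) a ha b hb hab
          ⟨v, hv.1, hav, hvb⟩
        refine ⟨c', Finset.mem_erase.2 ⟨?_, hc'⟩, hbd, hac', hbc'⟩
        rintro rfl
        have h1 := hxmin a hac'
        have h2 := hymax b hbc'
        exact hv.2 (hmemB v hv.1 (by order) (by order))
    have hxV : x ∈ V \ B :=
      Finset.mem_sdiff.2 ⟨hEV hx, fun hxB => lt_irrefl _ (hBmem x hxB).2.1⟩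
    have hyV : y ∈ V \ B :=
      Finset.mem_sdiff.2 ⟨hEV hy, fun hyB => lt_irrefl _ (hBmem y hyB).2.2⟩
    have := EarDecomposition.attach (ih _ (Finset.erase_ssubset hE) h') hxV hyV hxy
      (fun v hv hxvy => (Finset.mem_sdiff.1 hv).2
        (hmemB v (Finset.mem_sdiff.1 hv).1 hxvy.1 hxvy.2)) (fun v hv => (hBmem v hv).2) hBcard
    rwa [Finset.sdiff_union_of_subset hBV, hEB, Finset.insert_erase hE] at this
  · have hV : V = {lo, hi} := by
      ext v
      simp only [Finset.mem_insert, Finset.mem_singleton]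
      constructor
      · intro hv
        by_contra! hcon
        exact hne ⟨v, hv, lt_of_le_of_ne (h.bounds v hv).1 hcon.1.symm,
          lt_of_le_of_ne (h.bounds v hv).2 hcon.2⟩
      · rintro (rfl | rfl)
        exacts [h.lo_mem, h.hi_mem]
    have hT : T = ∅ := by
      rw [Finset.eq_empty_iff_forall_notMem]
      intro c hc
      have h1 := Finset.card_le_card (h.cell_subset c hc)
      rw [hV, h.cell_card c hc] at h1
      have h2 := Finset.card_le_two (a := lo) (b := hi)
      omega
    rw [hV, hT]
    exact .edge h.lo_lt_hi

end IsGaplessFamily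

end EarDecomposition

section Geometry

/-- Twice the signed area of the triangle `p q r`. -/
def orient (p q r : ℝ × ℝ) : ℝ :=
  (q.1 - p.1) * (r.2 - p.2) - (q.2 - p.2) * (r.1 - p.1)

lemma orient_cos_sin (x y z : ℝ) :
    orient (Real.cos (2 * x), Real.sin (2 * x)) (Real.cos (2 * y), Real.sin (2 * y))
      (Real.cos (2 * z), Real.sin (2 * z)) =
      4 * Real.sin (y - x) * Real.sin (z - y) * Real.sin (z - x) := by
  have hx := Real.sin_sq_add_cos_sq x
  have hy := Real.sin_sq_add_cos_sq y
  have hz := Real.sin_sq_add_cos_sq z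
  simp only [orient, Real.sin_sub, Real.cos_two_mul, Real.sin_two_mul]
  grind

lemma orient_vtx_pos {n : ℕ} [NeZero n] {a b c : ZMod n} (hab : a.val < b.val)
    (hbc : b.val < c.val) : 0 < orient (vtx n a) (vtx n b) (vtx n c) := by
  have hn : (0 : ℝ) < n := by exact_mod_cast NeZero.pos n
  have hv : ∀ k : ZMod n, vtx n k = (Real.cos (2 * (Real.pi * k.val / n)),
      Real.sin (2 * (Real.pi * k.val / n))) := fun k => by
    simp only [vtx]; ring_nf
  have hs : ∀ k l : ZMod n, k.val < l.val →
      0 < Real.sin (Real.pi * l.val / n - Real.pi * k.val / n) := by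
    intro k l hkl
    have h1 : (k.val : ℝ) < l.val := by exact_mod_cast hkl
    have h2 : (l.val : ℝ) < n := by exact_mod_cast ZMod.val_lt l
    have h3 : (0 : ℝ) ≤ k.val := by positivity
    have hpi := Real.pi_pos
    rw [← sub_div, ← mul_sub]
    apply Real.sin_pos_of_pos_of_lt_pi
    · have := sub_pos.2 h1
      positivity
    · rw [div_lt_iff₀ hn]
      exact mul_lt_mul_of_pos_left (by linarith) hpi
  rw [hv, hv, hv, orient_cos_sin]
  have h1 := hs a b hab
  have h2 := hs b c hbc
  have h3 := hs a c (hab.trans hbc)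
  positivity

lemma affineSpan_eq_top_of_orient_ne_zero {s : Set (ℝ × ℝ)} {p q r : ℝ × ℝ} (hp : p ∈ s)
    (hq : q ∈ s) (hr : r ∈ s) (h : orient p q r ≠ 0) : affineSpan ℝ s = ⊤ := by
  rw [eq_top_iff]
  intro x _
  have hp' := subset_affineSpan ℝ s hp
  have hq' := subset_affineSpan ℝ s hq
  have hr' := subset_affineSpan ℝ s hr
  have hx : x = (orient p x r / orient p q r) • (q -ᵥ p) +ᵥ
      ((orient p q x / orient p q r) • (r -ᵥ p) +ᵥ p) := by
    ext
    · simp only [vsub_eq_sub, vadd_eq_add, Prod.fst_add, Prod.smul_fst, Prod.fst_sub, smul_eq_mul]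
      field_simp
      simp only [orient]; ring
    · simp only [vsub_eq_sub, vadd_eq_add, Prod.snd_add, Prod.smul_snd, Prod.snd_sub, smul_eq_mul]
      field_simp
      simp only [orient]; ring
  rw [hx]
  exact AffineSubspace.smul_vsub_vadd_mem _ _ hq' hp'
    (AffineSubspace.smul_vsub_vadd_mem _ _ hr' hp' hp')

variable {n : ℕ} [NeZero n]

lemma interior_cellHull_nonempty {c : Finset (ZMod n)} (hc : 3 ≤ c.card) :
    (interior (cellHull n c)).Nonempty := by
  have key : ∃ a ∈ c, ∃ b ∈ c, ∃ e ∈ c, a.val < b.val ∧ b.val < e.val := by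
    obtain ⟨x, y, z, hx, hy, hz, hxy, hxz, hyz⟩ := Finset.two_lt_card_iff.1 hc
    have hxy' := (ZMod.val_injective n).ne hxy
    have hxz' := (ZMod.val_injective n).ne hxz
    have hyz' := (ZMod.val_injective n).ne hyz
    by_contra! h
    have h1 := h x hx y hy z hz
    have h2 := h x hx z hz y hy
    have h3 := h y hy x hx z hz
    have h4 := h y hy z hz x hx
    have h5 := h z hz x hx y hy
    have h6 := h z hz y hy x hx
    omega
  obtain ⟨a, ha, b, hb, e, he, hab, hbe⟩ := key
  exact interior_convexHull_nonempty_iff_affineSpan_eq_top.2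
    (affineSpan_eq_top_of_orient_ne_zero (Set.mem_image_of_mem _ ha) (Set.mem_image_of_mem _ hb)
      (Set.mem_image_of_mem _ he) (orient_vtx_pos hab hbe).ne.symm)

/-- Two cells with crossing chords have overlapping interiors. -/
lemma interior_inter_nonempty_of_crossing {c c' : Finset (ZMod n)} (hc : 3 ≤ c.card)
    (hc' : 3 ≤ c'.card) {a b u v : ZMod n} (ha : a ∈ c) (hb : b ∈ c) (hu : u ∈ c') (hv : v ∈ c')
    (hau : a.val < u.val) (hub : u.val < b.val) (hbv : b.val < v.val) :
    interior (cellHull n c) ∩ interior (cellHull n c') ≠ ∅ := by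
  intro hdisj
  have hconv : ∀ e : Finset (ZMod n), Convex ℝ (cellHull n e) := fun e => convex_convexHull ℝ _
  obtain ⟨f, s, hf, hf'⟩ := geometric_hahn_banach_open_open (hconv c).interior isOpen_interior
    (hconv c').interior isOpen_interior (Set.disjoint_iff_inter_eq_empty.2 hdisj)
  have hne := interior_cellHull_nonempty hc
  have hne' := interior_cellHull_nonempty hc'
  have hle : ∀ k ∈ c, f (vtx n k) ≤ s := by
    intro k hk
    have hk' : vtx n k ∈ closure (interior (cellHull n c)) := by
      rw [(hconv c).closure_interior_eq_closure_of_nonempty_interior hne]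
      exact subset_closure (subset_convexHull ℝ _ (Set.mem_image_of_mem _ hk))
    exact closure_minimal (fun x hx => (hf x hx).le) (isClosed_le f.continuous continuous_const) hk'
  have hge : ∀ k ∈ c', s ≤ f (vtx n k) := by
    intro k hk
    have hk' : vtx n k ∈ closure (interior (cellHull n c')) := by
      rw [(hconv c').closure_interior_eq_closure_of_nonempty_interior hne']
      exact subset_closure (subset_convexHull ℝ _ (Set.mem_image_of_mem _ hk))
    exact closure_minimal (fun x hx => (hf' x hx).le)
      (isClosed_le continuous_const f.continuous) hk'
  have hfc : ∀ p : ℝ × ℝ, f p = p.1 * f (1, 0) + p.2 * f (0, 1) := by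
    intro p
    have hp : p = p.1 • ((1, 0) : ℝ × ℝ) + p.2 • ((0, 1) : ℝ × ℝ) := by ext <;> simp
    calc f p = f (p.1 • ((1, 0) : ℝ × ℝ) + p.2 • ((0, 1) : ℝ × ℝ)) := congrArg f hp
      _ = p.1 * f (1, 0) + p.2 * f (0, 1) := by simp only [map_add, map_smul, smul_eq_mul]
  have h1 := orient_vtx_pos hau hub
  have h2 := orient_vtx_pos hub hbv
  have h3 := orient_vtx_pos hau (hub.trans hbv)
  have h4 := orient_vtx_pos (hau.trans hub) hbv
  have hrel : orient (vtx n u) (vtx n b) (vtx n v) * (f (vtx n a) - s) +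
      orient (vtx n a) (vtx n u) (vtx n v) * (f (vtx n b) - s) =
      orient (vtx n a) (vtx n b) (vtx n v) * (f (vtx n u) - s) +
      orient (vtx n a) (vtx n u) (vtx n b) * (f (vtx n v) - s) := by
    rw [hfc (vtx n a), hfc (vtx n b), hfc (vtx n u), hfc (vtx n v)]
    simp only [orient]; ring
  have ga := hle a ha
  have gb := hle b hb
  have gu := hge u hu
  have gv := hge v hv
  have e1 := mul_nonneg h2.le (sub_nonneg.2 ga)
  have e2 := mul_nonneg h3.le (sub_nonneg.2 gb)
  have e3 := mul_nonneg h4.le (sub_nonneg.2 gu)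
  have e4 := mul_nonneg h1.le (sub_nonneg.2 gv)
  have za : f (vtx n a) = s := by
    have : orient (vtx n u) (vtx n b) (vtx n v) * (s - f (vtx n a)) = 0 := by linarith
    rcases mul_eq_zero.1 this with h | h <;> linarith
  have zb : f (vtx n b) = s := by
    have : orient (vtx n a) (vtx n u) (vtx n v) * (s - f (vtx n b)) = 0 := by linarith
    rcases mul_eq_zero.1 this with h | h <;> linarith
  have zu : f (vtx n u) = s := by
    have : orient (vtx n a) (vtx n b) (vtx n v) * (f (vtx n u) - s) = 0 := by linarith
    rcases mul_eq_zero.1 this with h | h <;> linarith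
  have hf1 : orient (vtx n a) (vtx n u) (vtx n b) * f (1, 0) = 0 := by
    rw [hfc] at za zb zu
    simp only [orient]
    linear_combination ((vtx n b).2 - (vtx n a).2) * (zu - za) -
      ((vtx n u).2 - (vtx n a).2) * (zb - za)
  have hf2 : orient (vtx n a) (vtx n u) (vtx n b) * f (0, 1) = 0 := by
    rw [hfc] at za zb zu
    simp only [orient]
    linear_combination ((vtx n u).1 - (vtx n a).1) * (zb - za) -
      ((vtx n b).1 - (vtx n a).1) * (zu - za)
  have hf0 : ∀ p, f p = 0 := by
    intro p
    rw [hfc, (mul_eq_zero.1 hf1).resolve_left h1.ne', (mul_eq_zero.1 hf2).resolve_left h1.ne']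
    simp
  obtain ⟨x, hx⟩ := hne
  obtain ⟨y, hy⟩ := hne'
  have := hf x hx
  have := hf' y hy
  rw [hf0] at *
  linarith

lemma orient_combo (p q x y : ℝ × ℝ) {s t : ℝ} (hst : s + t = 1) :
    orient p (s • x + t • y) q = s * orient p x q + t * orient p y q := by
  simp only [orient, Prod.fst_add, Prod.snd_add, Prod.smul_fst, Prod.smul_snd, smul_eq_mul]
  linear_combination (p.1 * q.2 - p.2 * q.1) * hst

lemma convex_orient_pos_or_eq {p q r : ℝ × ℝ} (h : orient p r q = 0) :
    Convex ℝ {x | 0 < orient p x q ∨ x = r} := by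
  rw [convex_iff_forall_pos]
  intro x hx y hy s t hs ht hst
  simp only [Set.mem_ofPred_eq] at hx hy ⊢
  rcases hx with hx | rfl <;> rcases hy with hy | rfl
  · left; rw [orient_combo _ _ _ _ hst]; positivity
  · left; rw [orient_combo _ _ _ _ hst, h]; positivity
  · left; rw [orient_combo _ _ _ _ hst, h]; positivity
  · right; rw [← add_smul, hst, one_smul]

lemma convex_orient_nonpos (p q : ℝ × ℝ) : Convex ℝ {x | orient p x q ≤ 0} := by
  intro x hx y hy s t hs ht hst
  simp only [Set.mem_ofPred_eq] at hx hy ⊢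
  rw [orient_combo _ _ _ _ hst]
  nlinarith

lemma orient_swap (p q r : ℝ × ℝ) : orient p r q = -orient p q r := by
  simp only [orient]; ring

lemma orient_swap_left (p q r : ℝ × ℝ) : orient q p r = -orient p q r := by
  simp only [orient]; ring

lemma orient_self_left (p q : ℝ × ℝ) : orient p p q = 0 := by simp [orient]

lemma orient_self_right (p q : ℝ × ℝ) : orient p q q = 0 := by simp only [orient]; ring

lemma midpoint_eq_combo (p q : ℝ × ℝ) : midpoint ℝ p q = (2⁻¹ : ℝ) • p + (2⁻¹ : ℝ) • q := by
  rw [midpoint_eq_smul_add, smul_add, invOf_eq_inv]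

lemma orient_midpoint (p q : ℝ × ℝ) : orient p (midpoint ℝ p q) q = 0 := by
  rw [midpoint_eq_combo, orient_combo _ _ _ _ (by norm_num), orient_self_left, orient_self_right]
  simp

lemma mem_of_midpoint_mem_cellHull {c : Finset (ZMod n)} {a b w : ZMod n} (haw : a.val < w.val)
    (hwb : w.val < b.val) (hc : ∀ v ∈ c, a.val ≤ v.val ∧ v.val ≤ b.val)
    (hp : midpoint ℝ (vtx n a) (vtx n b) ∈ cellHull n c) : a ∈ c ∧ b ∈ c := by
  have hne : vtx n a ≠ vtx n b := by
    intro h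
    have := orient_vtx_pos haw hwb
    rw [h, orient_swap, orient_self_left] at this
    simp at this
  have hsub : ∀ z ∈ ({a, b} : Set (ZMod n)), (∀ v ∈ c, (a.val < v.val ∧ v.val < b.val) ∨ v = z) →
      midpoint ℝ (vtx n a) (vtx n b) = vtx n z := by
    intro z hz hcz
    have hz0 : orient (vtx n a) (vtx n z) (vtx n b) = 0 := by
      rcases hz with rfl | rfl
      · exact orient_self_left _ _
      · exact orient_self_right _ _
    have := convexHull_min (s := vtx n '' (c : Set (ZMod n))) ?_ (convex_orient_pos_or_eq hz0) hp
    · rcases this with h | h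
      · rw [orient_midpoint] at h
        exact absurd h (lt_irrefl _)
      · exact h
    · rintro _ ⟨v, hv, rfl⟩
      rcases hcz v hv with h | rfl
      · exact Or.inl (orient_vtx_pos h.1 h.2)
      · exact Or.inr rfl
  have hval : ∀ {v z : ZMod n}, v ≠ z → v.val ≠ z.val := fun h => (ZMod.val_injective n).ne h
  constructor
  · by_contra ha
    refine hne ((midpoint_eq_right_iff ℝ).1 (hsub b (by simp) fun v hv => ?_))
    by_cases hvb : v = b
    · exact Or.inr hvb
    · have h1 := hval (ne_of_mem_of_not_mem hv ha)
      have h2 := hval hvb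
      have := hc v hv
      exact Or.inl (by omega)
  · by_contra hb
    refine hne ((midpoint_eq_left_iff ℝ).1 (hsub a (by simp) fun v hv => ?_))
    by_cases hva : v = a
    · exact Or.inr hva
    · have h1 := hval (ne_of_mem_of_not_mem hv hb)
      have h2 := hval hva
      have := hc v hv
      exact Or.inl (by omega)

/-- If no cell has vertices both strictly inside and outside the arc from `a` to `b`, then the chord
`a b` is the side of a cell in that arc. -/
lemma exists_cell_of_gap {T : Finset (Finset (ZMod n))}
    (hcover : (⋃ c ∈ T, cellHull n c) = convexHull ℝ (Set.range (vtx n)))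
    {a b w : ZMod n} (haw : a.val < w.val) (hwb : w.val < b.val)
    (hT : ∀ c ∈ T, ∀ v ∈ c, a.val < v.val → v.val < b.val →
      ∀ u ∈ c, a.val ≤ u.val ∧ u.val ≤ b.val) :
    ∃ c ∈ T, (∀ u ∈ c, a.val ≤ u.val ∧ u.val ≤ b.val) ∧ a ∈ c ∧ b ∈ c := by
  set p := midpoint ℝ (vtx n a) (vtx n b) with hp
  set K := ⋃ c ∈ T.filter (fun c => ∀ u ∈ c, a.val ≤ u.val ∧ u.val ≤ b.val), cellHull n c with hK
  have hclosed : IsClosed K := isClosed_biUnion_finset fun c _ =>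
    (c.finite_toSet.image (vtx n)).isClosed_convexHull ℝ
  have hmemK : ∀ t : ℝ, t ∈ Set.Ioo (0 : ℝ) 1 → (1 - t) • p + t • vtx n w ∈ K := by
    intro t ⟨ht0, ht1⟩
    have hvtx : ∀ k, vtx n k ∈ convexHull ℝ (Set.range (vtx n)) := fun k =>
      subset_convexHull ℝ _ (Set.mem_range_self k)
    have hconv := convex_convexHull ℝ (Set.range (vtx n))
    have hmem := hconv (hconv.midpoint_mem (hvtx a) (hvtx b)) (hvtx w) (sub_nonneg.2 ht1.le) ht0.le
      (sub_add_cancel 1 t)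
    rw [← hcover] at hmem
    simp only [Set.mem_iUnion] at hmem
    obtain ⟨c, hcT, hmem⟩ := hmem
    obtain ⟨v, hv, hvpos⟩ : ∃ v ∈ c, 0 < orient (vtx n a) (vtx n v) (vtx n b) := by
      by_contra! h
      have hle := convexHull_min (s := vtx n '' (c : Set (ZMod n))) (by
        rintro _ ⟨v, hv, rfl⟩
        exact h v hv) (convex_orient_nonpos (vtx n a) (vtx n b)) hmem
      rw [Set.mem_ofPred_eq, orient_combo _ _ _ _ (sub_add_cancel 1 t), orient_midpoint] at hle
      have := mul_pos ht0 (orient_vtx_pos haw hwb)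
      linarith
    have hav : a.val < v.val := by
      by_contra! hva
      rcases hva.lt_or_eq with hva | hva
      · have := orient_vtx_pos hva (haw.trans hwb)
        rw [orient_swap_left] at this
        linarith
      · rw [ZMod.val_injective n hva, orient_self_left] at hvpos
        exact lt_irrefl _ hvpos
    have hvb : v.val < b.val := by
      by_contra! hbv
      rcases hbv.lt_or_eq with hbv | hbv
      · have := orient_vtx_pos (haw.trans hwb) hbv
        rw [orient_swap] at this
        linarith
      · rw [ZMod.val_injective n hbv, orient_self_right] at hvpos
        exact lt_irrefl _ hvpos
    simp only [hK, Set.mem_iUnion]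
    exact ⟨c, Finset.mem_filter.2 ⟨hcT, hT c hcT v hv hav hvb⟩, hmem⟩
  have hpK : p ∈ K := by
    have hcont : Continuous fun t : ℝ => (1 - t) • p + t • vtx n w := by fun_prop
    have htend := (hcont.tendsto 0).mono_left (nhdsWithin_le_nhds (s := Set.Ioi (0 : ℝ)))
    simp only [sub_zero, one_smul, zero_smul, add_zero] at htend
    refine hclosed.mem_of_tendsto htend ?_
    filter_upwards [Ioo_mem_nhdsGT (zero_lt_one' ℝ)] with t ht using hmemK t ht
  simp only [hK, Set.mem_iUnion] at hpK
  obtain ⟨c, hc, hpc⟩ := hpK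
  rw [Finset.mem_filter] at hc
  exact ⟨c, hc.1, hc.2, mem_of_midpoint_mem_cellHull haw hwb hc.2 hpc⟩

end Geometry

section Arcs

variable {n : ℕ} [NeZero n]

lemma ZMod.val_sub_eq_ite (a b : ZMod n) :
    (a - b).val = if b.val ≤ a.val then a.val - b.val else a.val + n - b.val := by
  split_ifs with h
  · exact ZMod.val_sub h
  · have hne : b - a ≠ 0 := fun h0 => h (by rw [sub_eq_zero.1 h0])
    have : NeZero (b - a) := ⟨hne⟩
    rw [← neg_sub, ZMod.val_neg_of_ne_zero, ZMod.val_sub (by omega)]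
    have := ZMod.val_lt b
    omega

lemma pathLen_add_one {i j : ZMod n} (hij : i ≠ j) (hn : 1 < n) :
    pathLen n i j + 1 = (j - i).val := by
  have h0 : (j - i).val ≠ 0 := by
    rw [Ne, ZMod.val_eq_zero, sub_eq_zero]
    exact hij.symm
  have h1 : (1 : ZMod n).val = 1 := by
    have : Fact (1 < n) := ⟨hn⟩
    exact ZMod.val_one n
  rw [pathLen, ZMod.val_sub (by omega), h1]
  omega

lemma val_one_add_natCast {i j : ZMod n} (hij : i ≠ j) (hn : 1 < n) (k : Fin (pathLen n i j)) :
    (1 + ((k : ℕ) : ZMod n)).val = k + 1 := by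
  have h := pathLen_add_one hij hn
  have := ZMod.val_lt (j - i)
  have hk : (1 + ((k : ℕ) : ZMod n)) = ((k + 1 : ℕ) : ZMod n) := by push_cast; ring
  rw [hk, ZMod.val_natCast_of_lt (by omega)]

lemma injective_one_add_natCast {i j : ZMod n} (hij : i ≠ j) (hn : 1 < n) :
    Function.Injective fun k : Fin (pathLen n i j) => 1 + ((k : ℕ) : ZMod n) := by
  intro k l hkl
  have h := congrArg ZMod.val hkl
  simp only [val_one_add_natCast hij hn] at h
  exact Fin.ext (by omega)

lemma exists_one_add_natCast_eq_iff {i j : ZMod n} (hij : i ≠ j) (hn : 1 < n) (w : ZMod n) :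
    (∃ k : Fin (pathLen n i j), 1 + ((k : ℕ) : ZMod n) = w) ↔
      0 < w.val ∧ w.val < (j - i).val := by
  have h := pathLen_add_one hij hn
  constructor
  · rintro ⟨k, rfl⟩
    rw [val_one_add_natCast hij hn]
    omega
  · rintro ⟨h0, h1⟩
    refine ⟨⟨w.val - 1, by omega⟩, ZMod.val_injective n ?_⟩
    rw [val_one_add_natCast hij hn]
    simp only
    omega

lemma dPathCount_eq_card_fillings {d : ℕ} {T : Finset (Finset (ZMod n))} {i j : ZMod n}
    (hij : i ≠ j) (hn : 1 < n) :
    dPathCount n d T i j = (fillings d T (Finset.univ.filter fun v : ZMod n =>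
      0 < (v - i).val ∧ (v - i).val < (j - i).val)).card := by
  refine natCard_sequences_eq_card_fillings
    (fun k : Fin (pathLen n i j) => i + 1 + ((k : ℕ) : ZMod n)) ?_ ?_
  · intro k l hkl
    exact injective_one_add_natCast hij hn (by simpa [add_assoc] using hkl)
  · ext v
    simp only [Finset.mem_image, Finset.mem_univ, true_and, Finset.mem_filter,
      ← exists_one_add_natCast_eq_iff hij hn, eq_sub_iff_add_eq']
    simp only [add_assoc]

lemma cwDPathCount_eq_card_fillings {d : ℕ} {T : Finset (Finset (ZMod n))} {i j : ZMod n}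
    (hij : i ≠ j) (hn : 1 < n) :
    cwDPathCount n d T i j = (fillings d T (Finset.univ.filter fun v : ZMod n =>
      0 < (i - v).val ∧ (i - v).val < (i - j).val)).card := by
  refine natCard_sequences_eq_card_fillings
    (fun k : Fin (pathLen n j i) => i - 1 - ((k : ℕ) : ZMod n)) ?_ ?_
  · intro k l hkl
    exact injective_one_add_natCast hij.symm hn (by simpa [sub_sub] using hkl)
  · ext v
    simp only [Finset.mem_image, Finset.mem_univ, true_and, Finset.mem_filter,
      ← exists_one_add_natCast_eq_iff hij.symm hn]
    refine exists_congr fun k => ?_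
    rw [sub_sub]
    rw [sub_eq_iff_eq_add, eq_sub_iff_add_eq, eq_comm, add_comm v]

end Arcs

section Dissection

variable {n d : ℕ} [NeZero n] {T : Finset (Finset (ZMod n))}

lemma IsDAngulation.noncrossing (hd : 3 ≤ d) (hT : IsDAngulation n d T) {c c' : Finset (ZMod n)}
    (hc : c ∈ T) (hc' : c' ∈ T) (hcc' : c ≠ c') {a b u v : ZMod n} (ha : a ∈ c) (hb : b ∈ c)
    (hu : u ∈ c') (hv : v ∈ c') (hau : a.val < u.val) (hub : u.val < b.val) :
    a.val ≤ v.val ∧ v.val ≤ b.val := by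
  have h3 := hd.trans_eq (hT.1 c hc).symm
  have h3' := hd.trans_eq (hT.1 c' hc').symm
  constructor
  · by_contra! hva
    exact interior_inter_nonempty_of_crossing h3' h3 hv hu ha hb hva hau hub
      (hT.2.2 c' hc' c hc hcc'.symm)
  · by_contra! hbv
    exact interior_inter_nonempty_of_crossing h3 h3' ha hb hu hv hau hub hbv
      (hT.2.2 c hc c' hc' hcc')

lemma IsDAngulation.card_fillings_inner_eq_outer (hd : 3 ≤ d) (hn : 1 < n)
    (hT : IsDAngulation n d T) {i j : ZMod n} (hij : i.val < j.val) :
    (fillings d T (Finset.univ.filter fun v : ZMod n => i.val < v.val ∧ v.val < j.val)).card =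
      (fillings d T (Finset.univ.filter fun v : ZMod n => v.val < i.val ∨ j.val < v.val)).card := by
  let _ : LinearOrder (ZMod n) := LinearOrder.lift' ZMod.val (ZMod.val_injective n)
  have hlt : ∀ a b : ZMod n, a < b ↔ a.val < b.val := fun _ _ => Iff.rfl
  have hhi : ((n - 1 : ℕ) : ZMod n).val = n - 1 := ZMod.val_natCast_of_lt (by omega)
  have hbounds : ∀ v : ZMod n, (0 : ZMod n).val ≤ v.val ∧ v.val ≤ ((n - 1 : ℕ) : ZMod n).val := by
    intro v
    rw [hhi, ZMod.val_zero]
    have := ZMod.val_lt v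
    omega
  have hfam : IsGaplessFamily d (0 : ZMod n) ((n - 1 : ℕ) : ZMod n) Finset.univ T := by
    refine ⟨Finset.mem_univ _, Finset.mem_univ _, ?_, fun v _ => hbounds v,
      fun c _ => Finset.subset_univ c, hT.1, ?_, ?_, ?_⟩
    · rw [hlt, hhi, ZMod.val_zero]
      omega
    · intro c hc c' hc' hcc' a ha b hb u hu hau hub v hv
      exact hT.noncrossing hd hc hc' hcc' ha hb hu hv hau hub
    · rintro ⟨w, -, hw0, hw1⟩
      obtain ⟨c, hc, -, h⟩ := exists_cell_of_gap hT.2.1 hw0 hw1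
        fun c _ v _ _ _ u _ => hbounds u
      exact ⟨c, hc, h⟩
    · rintro c hc a ha b hb hab ⟨w, -, haw, hwb⟩
      refine exists_cell_of_gap hT.2.1 haw hwb fun c' hc' v hv hav hvb u hu => ?_
      refine hT.noncrossing hd hc hc' ?_ ha hb hv hu hav hvb
      rintro rfl
      exact hab v hv ⟨hav, hvb⟩
  convert (hfam.earDecomposition hd).card_fillings_inner_eq_outer hd i (Finset.mem_univ i) j
    (Finset.mem_univ j) hij using 3 <;>
  · ext v
    simp only [Finset.mem_filter, hlt]

end Dissection

/-- For any `d`-angulation `T` of the convex `n`-gon and distinct vertices `i, j`,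
the number of counterclockwise `d`-paths from `i` to `j` equals the number of
clockwise `d`-paths from `i` to `j`. -/
theorem ccw_eq_cw (d m n : ℕ) (hd : 3 ≤ d) (hn : n = d + m * (d - 2))
    (T : Finset (Finset (ZMod n))) (hT : IsDAngulation n d T) (i j : ZMod n)
    (hij : i ≠ j) :
    dPathCount n d T i j = cwDPathCount n d T i j := by
  have hn1 : 1 < n := by
    rw [hn]
    exact lt_of_lt_of_le (by omega) (Nat.le_add_right d _)
  have : NeZero n := ⟨by omega⟩
  rw [dPathCount_eq_card_fillings hij hn1, cwDPathCount_eq_card_fillings hij hn1]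
  simp only [ZMod.val_sub_eq_ite]
  rcases lt_or_gt_of_ne ((ZMod.val_injective n).ne hij) with h | h
  · convert hT.card_fillings_inner_eq_outer hd hn1 h using 3 <;>
    · ext v
      have := ZMod.val_lt v
      have := ZMod.val_lt j
      simp only [Finset.mem_filter, Finset.mem_univ, true_and]
      split_ifs <;> omega
  · convert (hT.card_fillings_inner_eq_outer hd hn1 h).symm using 3 <;>
    · ext v
      have := ZMod.val_lt v
      have := ZMod.val_lt i
      simp only [Finset.mem_filter, Finset.mem_univ, true_and]
      split_ifs <;> omega
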